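/- arXiv:2111.08526 — 2 statements merged into one kernel-verified Lean document; each statement's English description precedes it below -/
import Mathlib

section
/- Let (X, Σ, μ) be a complete σ-finite measure space and ℓ a von Neumann lifting of μ. Let 𝔹 be a Banach space and Ω a 𝔹-valued measure on (X, Σ) of bounded variation with Ω ≪ μ. Suppose v ∈ ℒ¹(μ; 𝔹) satisfies Ω(E) = ∫_E v dμ for every E ∈ Σ. Then for μ-a.e. x ∈ X it holds that v(x) = lim_{I ⇒ x} Ω(I)/μ(I) in 𝔹, the limit being taken with respect to the differentiation basis 𝓘^ℓ. -/
open MeasureTheory Set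

/-- A von Neumann lifting of a measure `μ`: a Boolean homomorphism `ℓ : Σ → Σ` selecting
a.e.-representatives. -/
structure IsVNLifting {X : Type*} [MeasurableSpace X] (μ : MeasureTheory.Measure X)
    (ℓ : Set X → Set X) : Prop where
  measurableSet : ∀ E : Set X, MeasurableSet E → MeasurableSet (ℓ E)
  map_empty : ℓ (∅ : Set X) = ∅
  map_univ : ℓ (Set.univ : Set X) = Set.univ
  map_inter : ∀ E F : Set X, MeasurableSet E → MeasurableSet F → ℓ (E ∩ F) = ℓ E ∩ ℓ F
  map_union : ∀ E F : Set X, MeasurableSet E → MeasurableSet F → ℓ (E ∪ F) = ℓ E ∪ ℓ F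
  congr_ae : ∀ E F : Set X, MeasurableSet E → MeasurableSet F →
    μ (symmDiff E F) = 0 → ℓ E = ℓ F
  ae_symmDiff : ∀ E : Set X, MeasurableSet E → μ (symmDiff E (ℓ E)) = 0
/-- The differentiation basis `𝓘^ℓ` induced by a lifting `ℓ`: all sets `ℓ E` with
`E` measurable of positive finite measure. -/
def liftBasis {X : Type*} [MeasurableSpace X] (μ : MeasureTheory.Measure X)
    (ℓ : Set X → Set X) : Set (Set X) :=
  {I | ∃ E : Set X, MeasurableSet E ∧ 0 < μ E ∧ μ E < ⊤ ∧ I = ℓ E}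

/-- `HasDLim ℐ x Φ y` means `lim_{I ⇒ x} Φ(I) = y` along the differentiation basis `ℐ`:
for every neighbourhood `U` of `y` there is `I ∈ ℐ_x` with `Φ J ∈ U` for every
`J ∈ ℐ_x` with `J ⊆ I`. -/
def HasDLim {X Y : Type*} [TopologicalSpace Y] (ℐ : Set (Set X)) (x : X)
    (Φ : Set X → Y) (y : Y) : Prop :=
  ∀ U ∈ nhds y, ∃ I ∈ ℐ, x ∈ I ∧ ∀ J ∈ ℐ, x ∈ J → J ⊆ I → Φ J ∈ U
/-- The variation `‖Ω‖_B` of a vector measure `Ω`, evaluated on a set `E`: the supremum of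
`Σᵢ ‖Ω Eᵢ‖` over all finite measurable partitions of `E`. -/
noncomputable def vmVariation {X B : Type*} [MeasurableSpace X] [NormedAddCommGroup B]
    (Ω : MeasureTheory.VectorMeasure X B) (E : Set X) : ENNReal :=
  ⨆ (P : Finset (Set X)) (_ : (∀ A ∈ P, MeasurableSet A) ∧
      ((P : Set (Set X)).PairwiseDisjoint id) ∧ ⋃₀ (P : Set (Set X)) = E),
    ∑ A ∈ P, (‖Ω A‖₊ : ENNReal)

namespace IsVNLifting

variable {X B : Type*} [MeasurableSpace X] {μ : Measure X} {ℓ : Set X → Set X}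

theorem ae_eq (hℓ : IsVNLifting μ ℓ) {E : Set X} (hE : MeasurableSet E) : ℓ E =ᵐ[μ] E :=
  (measure_symmDiff_eq_zero_iff.mp (hℓ.ae_symmDiff E hE)).symm

theorem measure_ne_zero (hℓ : IsVNLifting μ ℓ) {E : Set X} (hE : MeasurableSet E) {x : X}
    (hx : x ∈ ℓ E) : μ E ≠ 0 := by
  intro h0
  rw [hℓ.congr_ae E ∅ hE MeasurableSet.empty (by simpa using h0), hℓ.map_empty] at hx
  exact hx

/-- If `v` stays in the closed convex set `s` on `E`, so do its averages over the members of the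
differentiation basis contained in `ℓ E`. -/
theorem setAverage_mem [NormedAddCommGroup B] [NormedSpace ℝ B] [CompleteSpace B]
    (hℓ : IsVNLifting μ ℓ) {v : X → B} (hv : Integrable v μ) {s : Set B} (hs : Convex ℝ s)
    (hsc : IsClosed s) {E : Set X} (hE : MeasurableSet E) (hEs : ∀ y ∈ E, v y ∈ s)
    {J : Set X} (hJ : J ∈ liftBasis μ ℓ) (hJE : J ⊆ ℓ E) : ⨍ y in J, v y ∂μ ∈ s := by
  obtain ⟨F, hF, hF0, hFtop, rfl⟩ := hJ
  have hμ : μ (ℓ F) = μ F := measure_congr (hℓ.ae_eq hF)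
  refine hs.set_average_mem hsc (hμ ▸ hF0.ne') (hμ ▸ hFtop.ne) ?_ hv.integrableOn
  rw [ae_restrict_iff' (hℓ.measurableSet F hF)]
  filter_upwards [(hℓ.ae_eq hE).mem_iff] with y hy hyF
  exact hEs y (hy.mp (hJE hyF))

end IsVNLifting

/-- **Differentiation of vector-valued measures.** If `Ω` is a `B`-valued measure of bounded
variation with `Ω ≪ μ` and `v` is its Radon–Nikodým density, then for μ-a.e. `x` the ratios
`Ω(I)/μ(I)` converge to `v x` along the differentiation basis induced by a von Neumann
lifting. -/
theorem differentiation_of_vector_measures {X B : Type*} [MeasurableSpace X]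
    [NormedAddCommGroup B] [NormedSpace ℝ B] [CompleteSpace B]
    (μ : Measure X) [SigmaFinite μ] (hc : μ.IsComplete)
    (ℓ : Set X → Set X) (hℓ : IsVNLifting μ ℓ)
    (Ω : VectorMeasure X B) (hBV : vmVariation Ω Set.univ < ⊤)
    (hAC : ∀ N : Set X, MeasurableSet N → μ N = 0 → Ω N = 0)
    (v : X → B) (hvm : StronglyMeasurable v) (hv1 : Integrable v μ)
    (hrep : ∀ E : Set X, MeasurableSet E → Ω E = ∫ z in E, v z ∂μ) :
    ∀ᵐ x ∂μ, HasDLim (liftBasis μ ℓ) x (fun I => (μ I).toReal⁻¹ • Ω I) (v x) := by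
  obtain ⟨D, hD, hvD⟩ := hvm.isSeparable_range
  have := hD.to_subtype
  let E : D → ℕ → ℕ → Set X := fun c n k =>
    v ⁻¹' Metric.ball c (1 / (n + 1 : ℝ)) ∩ spanningSets μ k
  have hE (c n k) : MeasurableSet (E c n k) :=
    (measurableSet_lt (hvm.dist stronglyMeasurable_const).measurable measurable_const).inter
      (measurableSet_spanningSets μ k)
  have key : ∀ᵐ x ∂μ, ∀ c n k, x ∈ E c n k → x ∈ ℓ (E c n k) := by
    simp only [ae_all_iff]
    intro c n k
    filter_upwards [(hℓ.ae_eq (hE c n k)).mem_iff] with x hx using hx.mpr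
  filter_upwards [key] with x hx U hU
  obtain ⟨ε, hε, hεU⟩ := Metric.mem_nhds_iff.mp hU
  obtain ⟨n, hn⟩ := exists_nat_one_div_lt (half_pos hε)
  obtain ⟨c, hcD, hxc⟩ := Metric.mem_closure_iff.mp (hvD (mem_range_self x)) _
    (Nat.one_div_pos_of_nat (α := ℝ) (n := n))
  have hxE := hx ⟨c, hcD⟩ n (spanningSetsIndex μ x) ⟨hxc, mem_spanningSetsIndex μ x⟩
  refine ⟨_, ⟨_, hE _ _ _, (hℓ.measure_ne_zero (hE _ _ _) hxE).bot_lt,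
    (measure_mono inter_subset_right).trans_lt (measure_spanningSets_lt_top μ _), rfl⟩, hxE,
    fun J hJ _ hJE => hεU ?_⟩
  have hJm : MeasurableSet J := by
    obtain ⟨F, hF, -, -, rfl⟩ := hJ
    exact hℓ.measurableSet F hF
  have havg := hℓ.setAverage_mem hv1 (convex_closedBall c (1 / (n + 1 : ℝ)))
    Metric.isClosed_closedBall (hE ⟨c, hcD⟩ n (spanningSetsIndex μ x))
    (fun _ hy => Metric.ball_subset_closedBall hy.1) hJ hJE
  rw [setAverage_eq, ← hrep J hJm, measureReal_def, Metric.mem_closedBall] at havg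
  rw [Metric.mem_ball]
  linarith [dist_triangle_right ((μ J).toReal⁻¹ • Ω J) (v x) c]
end

section
/- Let (X, Σ, μ) be a complete finite measure space and ℓ a von Neumann lifting of μ. Let 𝒜(ℓ) := {x ∈ X : the partially ordered set (𝓘^ℓ_x, ⊆) has a least element}. Then 𝒜(ℓ) equals the union of ℓ(A) over all atoms A of μ; in particular 𝒜(ℓ) ∈ Σ. -/
open MeasureTheory Set

/-- `A` is an atom of the measure `μ`: a measurable set of positive measure such that every
measurable subset either is null or has null complement in `A`. -/
def IsMeasureAtom {X : Type*} [MeasurableSpace X] (μ : MeasureTheory.Measure X)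
    (A : Set X) : Prop :=
  MeasurableSet A ∧ 0 < μ A ∧
    ∀ B : Set X, MeasurableSet B → B ⊆ A → μ B = 0 ∨ μ (A \ B) = 0

namespace IsVNLifting

variable {X : Type*} [MeasurableSpace X] {μ : Measure X} {ℓ : Set X → Set X}

theorem measure_eq (hℓ : IsVNLifting μ ℓ) {E : Set X} (hE : MeasurableSet E) :
    μ (ℓ E) = μ E :=
  (measure_congr (measure_symmDiff_eq_zero_iff.mp (hℓ.ae_symmDiff E hE))).symm

theorem eq_empty_iff (hℓ : IsVNLifting μ ℓ) {E : Set X} (hE : MeasurableSet E) :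
    ℓ E = ∅ ↔ μ E = 0 := by
  refine ⟨fun h => by rw [← hℓ.measure_eq hE, h, measure_empty], fun h => ?_⟩
  rw [← hℓ.map_empty]
  exact hℓ.congr_ae E ∅ hE .empty (by simpa [symmDiff_def] using h)

theorem measure_pos_of_mem (hℓ : IsVNLifting μ ℓ) {E : Set X} (hE : MeasurableSet E) {x : X}
    (hx : x ∈ ℓ E) : 0 < μ E :=
  pos_iff_ne_zero.mpr fun h => by simp [(hℓ.eq_empty_iff hE).mpr h] at hx

theorem disjoint (hℓ : IsVNLifting μ ℓ) {E F : Set X} (hE : MeasurableSet E)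
    (hF : MeasurableSet F) (h : Disjoint E F) : Disjoint (ℓ E) (ℓ F) := by
  rw [disjoint_iff_inter_eq_empty, ← hℓ.map_inter E F hE hF, h.inter_eq, hℓ.map_empty]

theorem mono (hℓ : IsVNLifting μ ℓ) {E F : Set X} (hE : MeasurableSet E)
    (hF : MeasurableSet F) (h : E ⊆ F) : ℓ E ⊆ ℓ F := by
  rw [← union_eq_self_of_subset_left h, hℓ.map_union E F hE hF]
  exact subset_union_left

/-- The lifting of an atom is contained in the lifting of every measurable set it meets. -/
theorem subset_of_isMeasureAtom (hℓ : IsVNLifting μ ℓ) {A F : Set X} (hA : IsMeasureAtom μ A)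
    (hF : MeasurableSet F) {x : X} (hxA : x ∈ ℓ A) (hxF : x ∈ ℓ F) : ℓ A ⊆ ℓ F := by
  have hAF := hA.1.inter hF
  have hx : x ∈ ℓ (A ∩ F) := by
    rw [hℓ.map_inter A F hA.1 hF]
    exact ⟨hxA, hxF⟩
  have hnull : μ (A \ F) = 0 := by
    have := (hA.2.2 (A ∩ F) hAF inter_subset_left).resolve_left
      (hℓ.measure_pos_of_mem hAF hx).ne'
    rwa [sdiff_self_inter] at this
  rw [← inter_union_sdiff A F, hℓ.map_union _ _ hAF (hA.1.diff hF),
    (hℓ.eq_empty_iff (hA.1.diff hF)).mpr hnull, union_empty]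
  exact hℓ.mono hAF hF inter_subset_right

/-- A measurable set whose lifting is least among the basis sets containing a point is an atom. -/
theorem isMeasureAtom_of_least [IsFiniteMeasure μ] (hℓ : IsVNLifting μ ℓ) {E : Set X}
    (hE : MeasurableSet E) {x : X} (hx : x ∈ ℓ E)
    (hleast : ∀ J ∈ liftBasis μ ℓ, x ∈ J → ℓ E ⊆ J) : IsMeasureAtom μ E := by
  have key : ∀ {B C : Set X}, MeasurableSet B → MeasurableSet C → Disjoint B C → C ⊆ E →
      x ∈ ℓ B → μ C = 0 := by
    intro B C hB hC hBC hCE hxB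
    have hEB : ℓ E ⊆ ℓ B :=
      hleast _ ⟨B, hB, hℓ.measure_pos_of_mem hB hxB, measure_lt_top μ B, rfl⟩ hxB
    exact (hℓ.eq_empty_iff hC).mp <| subset_empty_iff.mp <|
      hℓ.disjoint hB hC hBC ((hℓ.mono hC hE hCE).trans hEB) subset_rfl
  refine ⟨hE, hℓ.measure_pos_of_mem hE hx, fun B hB hBE => ?_⟩
  have hEB := hE.diff hB
  rw [← union_sdiff_cancel hBE, hℓ.map_union _ _ hB hEB] at hx
  rcases hx with hx | hx
  · exact .inr (key hB hEB disjoint_sdiff_right sdiff_subset hx)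
  · exact .inl (key hEB hB disjoint_sdiff_left hBE hx)

theorem countable_image_isMeasureAtom [IsFiniteMeasure μ] (hℓ : IsVNLifting μ ℓ) :
    (ℓ '' {A | IsMeasureAtom μ A}).Countable := by
  set S := ℓ '' {A | IsMeasureAtom μ A}
  have hcount := Measure.countable_meas_pos_of_disjoint_iUnion (μ := μ)
    (As := fun s : S => (s : Set X))
    (by rintro ⟨_, A, hA, rfl⟩; exact hℓ.measurableSet A hA.1)
    (by
      rintro ⟨_, A, hA, rfl⟩ ⟨_, B, hB, rfl⟩ hne
      refine disjoint_left.mpr fun x hxA hxB => hne (Subtype.ext ?_)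
      exact (hℓ.subset_of_isMeasureAtom hA hB.1 hxA hxB).antisymm
        (hℓ.subset_of_isMeasureAtom hB hA.1 hxB hxA))
  refine (hcount.image Subtype.val).mono ?_
  rintro _ ⟨A, hA, rfl⟩
  refine ⟨⟨ℓ A, A, hA, rfl⟩, ?_, rfl⟩
  simpa [hℓ.measure_eq hA.1] using hA.2.1

theorem measurableSet_biUnion_isMeasureAtom [IsFiniteMeasure μ] (hℓ : IsVNLifting μ ℓ) :
    MeasurableSet (⋃ (A : Set X) (_ : IsMeasureAtom μ A), ℓ A) := by
  have h : (⋃ (A : Set X) (_ : IsMeasureAtom μ A), ℓ A) = ⋃₀ (ℓ '' {A | IsMeasureAtom μ A}) := by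
    rw [sUnion_image]
    rfl
  rw [h]
  refine .sUnion hℓ.countable_image_isMeasureAtom ?_
  rintro _ ⟨A, hA, rfl⟩
  exact hℓ.measurableSet A hA.1

end IsVNLifting

/-- The set `𝒜(ℓ)` of points `x` at which the family `𝓘^ℓ_x` has a least element (for
inclusion) coincides with the union of the sets `ℓ A` over all atoms `A` of `μ`;
in particular it is measurable. -/
theorem least_element_set_eq_union_of_atoms {X : Type*} [MeasurableSpace X]
    (μ : Measure X) [IsFiniteMeasure μ] (hc : μ.IsComplete)
    (ℓ : Set X → Set X) (hℓ : IsVNLifting μ ℓ) :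
    ({x : X | ∃ I ∈ liftBasis μ ℓ, x ∈ I ∧ ∀ J ∈ liftBasis μ ℓ, x ∈ J → I ⊆ J}
        = ⋃ (A : Set X) (_ : IsMeasureAtom μ A), ℓ A) ∧
      MeasurableSet
        {x : X | ∃ I ∈ liftBasis μ ℓ, x ∈ I ∧ ∀ J ∈ liftBasis μ ℓ, x ∈ J → I ⊆ J} := by
  have heq : {x : X | ∃ I ∈ liftBasis μ ℓ, x ∈ I ∧ ∀ J ∈ liftBasis μ ℓ, x ∈ J → I ⊆ J}
      = ⋃ (A : Set X) (_ : IsMeasureAtom μ A), ℓ A := by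
    ext x
    simp only [mem_ofPred_eq, mem_iUnion, exists_prop]
    constructor
    · rintro ⟨_, ⟨E, hE, -, -, rfl⟩, hx, hleast⟩
      exact ⟨E, hℓ.isMeasureAtom_of_least hE hx hleast, hx⟩
    · rintro ⟨A, hA, hx⟩
      refine ⟨ℓ A, ⟨A, hA.1, hA.2.1, measure_lt_top μ A, rfl⟩, hx, ?_⟩
      rintro _ ⟨F, hF, -, -, rfl⟩ hxF
      exact hℓ.subset_of_isMeasureAtom hA hF hx hxF
  exact ⟨heq, heq ▸ hℓ.measurableSet_biUnion_isMeasureAtom⟩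
end
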